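/- (Mehler) For a ≠ 0 real, the kernel e_a(x,y,t) = (4π sinh(2at)/(2a))^{-1/2} exp(-(cosh(2at)(x²+y²) - 2xy)/(4 sinh(2at)/(2a))) satisfies the PDE ∂_t e_a = ∂_x² e_a - a²x² e_a for t > 0, and for continuous bounded f, u(x,t) = ∫_ℝ e_a(x,y,t) f(y) dy satisfies u_t = u_xx - a²x²u with u(·,t) → f as t → 0⁺. -/

import Mathlib

/-- The Mehler kernel
`e_a(x,y,t) = (4π sinh(2at)/(2a))^{-1/2} exp(-(cosh(2at)(x²+y²) - 2xy)/(4 sinh(2at)/(2a)))`. -/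
noncomputable def mehler (a x y t : ℝ) : ℝ :=
  (Real.sqrt (4 * Real.pi * (Real.sinh (2 * a * t) / (2 * a))))⁻¹ *
    Real.exp (-(Real.cosh (2 * a * t) * (x ^ 2 + y ^ 2) - 2 * x * y) /
      (4 * (Real.sinh (2 * a * t) / (2 * a))))

open Filter Topology MeasureTheory

lemma ms_pos {a : ℝ} (ha : a ≠ 0) {t : ℝ} (ht : 0 < t) : 0 < Real.sinh (2 * a * t) / (2 * a) := by
  rcases lt_or_gt_of_ne ha with h | h
  · apply div_pos_of_neg_of_neg
    · rw [Real.sinh_neg_iff]; nlinarith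
    · linarith
  · apply div_pos
    · rw [Real.sinh_pos_iff]; positivity
    · linarith

lemma ms_deriv {a : ℝ} (ha : a ≠ 0) (t : ℝ) :
    HasDerivAt (fun t => Real.sinh (2 * a * t) / (2 * a)) (Real.cosh (2 * a * t)) t := by
  have h := (((hasDerivAt_id t).const_mul (2 * a)).sinh).div_const (2 * a)
  refine h.congr_deriv ?_
  simp only [id]
  field_simp

lemma mc_deriv {a : ℝ} (ha : a ≠ 0) (t : ℝ) :
    HasDerivAt (fun t => Real.cosh (2 * a * t))
      (4 * a ^ 2 * (Real.sinh (2 * a * t) / (2 * a))) t := by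
  have h := (((hasDerivAt_id t).const_mul (2 * a)).cosh)
  refine h.congr_deriv ?_
  simp only [id]
  field_simp
  ring

lemma mc_sq {a : ℝ} (ha : a ≠ 0) (t : ℝ) :
    Real.cosh (2 * a * t) ^ 2 = 1 + 4 * a ^ 2 * (Real.sinh (2 * a * t) / (2 * a)) ^ 2 := by
  rw [Real.cosh_sq]; field_simp; ring

lemma m_dx (a x y t : ℝ) :
    HasDerivAt (fun x => mehler a x y t)
      ((-(Real.cosh (2 * a * t) * x - y) / (2 * (Real.sinh (2 * a * t) / (2 * a)))) *
        mehler a x y t) x := by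
  unfold mehler
  generalize Real.cosh (2 * a * t) = c
  generalize Real.sinh (2 * a * t) / (2 * a) = s
  have h1 : HasDerivAt (fun x : ℝ => -(c * (x ^ 2 + y ^ 2) - 2 * x * y) / (4 * s))
      (-(c * (2 * x) - 2 * y) / (4 * s)) x := by
    have := (((((hasDerivAt_pow 2 x).add_const (y ^ 2)).const_mul c).sub
      (((hasDerivAt_id x).const_mul 2).mul_const y)).neg).div_const (4 * s)
    refine this.congr_deriv ?_
    simp
  have h2 := h1.exp.const_mul (Real.sqrt (4 * Real.pi * s))⁻¹
  refine h2.congr_deriv ?_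
  have : -(c * x - y) / (2 * s) = -(c * (2 * x) - 2 * y) / (4 * s) := by
    by_cases hs : s = 0
    · simp [hs]
    · field_simp; ring
  rw [this]; ring

lemma m_dt {a : ℝ} (ha : a ≠ 0) (x y : ℝ) {t : ℝ} (ht : 0 < t) :
    HasDerivAt (fun t => mehler a x y t)
      ((-Real.cosh (2 * a * t) / (2 * (Real.sinh (2 * a * t) / (2 * a))) - a ^ 2 * (x ^ 2 + y ^ 2)
        + (Real.cosh (2 * a * t) * (x ^ 2 + y ^ 2) - 2 * x * y) * Real.cosh (2 * a * t) /
          (4 * (Real.sinh (2 * a * t) / (2 * a)) ^ 2)) *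
        mehler a x y t) t := by
  have hs := ms_deriv ha t
  have hc := mc_deriv ha t
  have h0 := ms_pos ha ht
  unfold mehler
  set S : ℝ → ℝ := fun t => Real.sinh (2 * a * t) / (2 * a) with hS
  set Cc : ℝ → ℝ := fun t => Real.cosh (2 * a * t) with hC
  change HasDerivAt S (Cc t) t at hs
  change HasDerivAt Cc (4 * a ^ 2 * S t) t at hc
  change 0 < S t at h0
  change HasDerivAt (fun t => (Real.sqrt (4 * Real.pi * S t))⁻¹ *
    Real.exp (-(Cc t * (x ^ 2 + y ^ 2) - 2 * x * y) / (4 * S t)))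
    ((-Cc t / (2 * S t) - a ^ 2 * (x ^ 2 + y ^ 2) +
      (Cc t * (x ^ 2 + y ^ 2) - 2 * x * y) * Cc t / (4 * S t ^ 2)) *
      ((Real.sqrt (4 * Real.pi * S t))⁻¹ *
    Real.exp (-(Cc t * (x ^ 2 + y ^ 2) - 2 * x * y) / (4 * S t)))) t
  have hp : 0 < 4 * Real.pi * S t := by positivity
  have hq : 0 < Real.sqrt (4 * Real.pi * S t) := Real.sqrt_pos.2 hp
  have h1 := ((hs.const_mul (4 * Real.pi)).sqrt hp.ne').inv hq.ne'
  have h2 := ((((hc.mul_const (x ^ 2 + y ^ 2)).sub_const (2 * x * y)).neg).div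
    (hs.const_mul 4) (by positivity)).exp
  have h3 := h1.mul h2
  refine h3.congr_deriv ?_
  have e1 : -(4 * Real.pi * Cc t / (2 * √(4 * Real.pi * S t))) / √(4 * Real.pi * S t) ^ 2
     = -Cc t / (2 * S t) * (√(4 * Real.pi * S t))⁻¹ := by
    rw [Real.sq_sqrt hp.le]; field_simp
  simp only [Pi.inv_apply, Pi.div_apply, Pi.neg_apply, Pi.mul_apply]
  rw [e1]
  have e2 : (-(4 * a ^ 2 * S t * (x ^ 2 + y ^ 2)) * (4 * S t) -
      -(Cc t * (x ^ 2 + y ^ 2) - 2 * x * y) * (4 * Cc t)) / (4 * S t) ^ 2 =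
      - a ^ 2 * (x ^ 2 + y ^ 2) +
      (Cc t * (x ^ 2 + y ^ 2) - 2 * x * y) * Cc t / (4 * S t ^ 2) := by
    field_simp; ring
  rw [e2]
  ring

lemma m_dxx (a x y t : ℝ) :
    HasDerivAt (fun x => (-(Real.cosh (2 * a * t) * x - y) /
      (2 * (Real.sinh (2 * a * t) / (2 * a)))) * mehler a x y t)
      (((Real.cosh (2 * a * t) * x - y) ^ 2 / (4 * (Real.sinh (2 * a * t) / (2 * a)) ^ 2)
        - Real.cosh (2 * a * t) / (2 * (Real.sinh (2 * a * t) / (2 * a)))) *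
        mehler a x y t) x := by
  have h := m_dx a x y t
  generalize Real.cosh (2 * a * t) = c at *
  generalize Real.sinh (2 * a * t) / (2 * a) = s at *
  have h1 : HasDerivAt (fun x : ℝ => -(c * x - y) / (2 * s)) (-c / (2 * s)) x := by
    have := ((((hasDerivAt_id x).const_mul c).sub_const y).neg).div_const (2 * s)
    refine this.congr_deriv ?_
    simp
  refine (h1.mul h).congr_deriv ?_
  by_cases hs : s = 0
  · simp [hs]
  · field_simp; ring

/-- The pointwise algebraic identity behind the PDE. -/
lemma m_alg {a : ℝ} (ha : a ≠ 0) (x y : ℝ) {t : ℝ} (ht : 0 < t) :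
    (-Real.cosh (2 * a * t) / (2 * (Real.sinh (2 * a * t) / (2 * a))) - a ^ 2 * (x ^ 2 + y ^ 2)
        + (Real.cosh (2 * a * t) * (x ^ 2 + y ^ 2) - 2 * x * y) * Real.cosh (2 * a * t) /
          (4 * (Real.sinh (2 * a * t) / (2 * a)) ^ 2)) =
    ((Real.cosh (2 * a * t) * x - y) ^ 2 / (4 * (Real.sinh (2 * a * t) / (2 * a)) ^ 2)
        - Real.cosh (2 * a * t) / (2 * (Real.sinh (2 * a * t) / (2 * a)))) - a ^ 2 * x ^ 2 := by
  have h0 := (ms_pos ha ht).ne'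
  have h := mc_sq ha t
  generalize Real.cosh (2 * a * t) = c at *
  generalize Real.sinh (2 * a * t) / (2 * a) = s at *
  field_simp
  linear_combination 2 * y ^ 2 * h

/-- Local uniform Gaussian bound. -/
lemma m_bound {a : ℝ} (ha : a ≠ 0) {t : ℝ} (ht : 0 < t) :
    ∃ K β : ℝ, 0 < K ∧ 0 < β ∧ ∀ᶠ t' in 𝓝 t, ∀ x y : ℝ,
      |mehler a x y t'| ≤ K * Real.exp (-β * y ^ 2) := by
  have hs := (ms_deriv ha t).continuousAt
  have hc := (mc_deriv ha t).continuousAt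
  have h0 := ms_pos ha ht
  have h1 : 1 < Real.cosh (2 * a * t) := Real.one_lt_cosh.2 (by positivity)
  have b1 := hs.eventually (lt_mem_nhds (half_lt_self h0))
  have b2 := hs.eventually (gt_mem_nhds (show _ < 2 * (Real.sinh (2 * a * t) / (2 * a)) by linarith))
  have b3 := hc.eventually (lt_mem_nhds
    (show (1 + Real.cosh (2 * a * t)) / 2 < Real.cosh (2 * a * t) by linarith))
  set s := Real.sinh (2 * a * t) / (2 * a)
  set c := Real.cosh (2 * a * t)
  refine ⟨(Real.sqrt (4 * Real.pi * (s / 2)))⁻¹, ((1 + c) / 2 - 1) / (4 * (2 * s)), by positivity,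
    div_pos (by linarith) (by linarith), ?_⟩
  filter_upwards [b1, b2, b3] with t' b1 b2 b3 x y
  unfold mehler
  generalize Real.sinh (2 * a * t') / (2 * a) = s' at *
  generalize Real.cosh (2 * a * t') = c' at *
  have hs' : 0 < s' := by linarith
  rw [abs_of_nonneg (by positivity)]
  gcongr
  rw [← neg_mul_eq_neg_mul, neg_div, neg_le_neg_iff, div_mul_eq_mul_div]
  have : 0 ≤ ((1 + c) / 2 - 1) * y ^ 2 := mul_nonneg (by linarith) (by positivity)
  have h5 : ((1 + c) / 2 - 1) * y ^ 2 ≤ c' * (x ^ 2 + y ^ 2) - 2 * x * y := by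
    nlinarith [sq_nonneg (x - y), mul_nonneg (show 0 ≤ c' - (1 + c) / 2 by linarith) (sq_nonneg y),
      mul_nonneg (show 0 ≤ c' - 1 by linarith) (sq_nonneg x)]
  have h6 := this.trans h5
  gcongr

lemma m_cont (a x t : ℝ) : Continuous (fun y => mehler a x y t) := by
  unfold mehler; fun_prop

lemma gauss_int {β : ℝ} (hβ : 0 < β) (K : ℝ) :
    Integrable (fun y : ℝ => K * ((1 + y ^ 2) * Real.exp (-β * y ^ 2))) := by
  have h1 := integrable_exp_neg_mul_sq hβ
  have h2 := integrable_rpow_mul_exp_neg_mul_sq hβ (s := 2) (by norm_num)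
  refine ((h1.add h2).congr ?_).const_mul K
  filter_upwards with y
  simp
  ring

/-- Local bound for polynomial multiples of the kernel. -/
lemma key_bound {a : ℝ} (ha : a ≠ 0) {f : ℝ → ℝ} {M : ℝ} (hM : ∀ y, |f y| ≤ M)
    {xf tf A B C : ℝ → ℝ} {p : ℝ} (htf : ContinuousAt tf p) (htp : 0 < tf p)
    (hA : ContinuousAt A p) (hB : ContinuousAt B p) (hC : ContinuousAt C p) :
    ∃ g : ℝ → ℝ, Integrable g ∧ ∀ᶠ q in 𝓝 p, ∀ y,
      ‖(A q + B q * y + C q * y ^ 2) * mehler a (xf q) y (tf q) * f y‖ ≤ g y := by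
  obtain ⟨K, β, hK, hβ, hb⟩ := m_bound ha htp
  refine ⟨_, gauss_int hβ ((|A p| + 1 + (|B p| + 1) + (|C p| + 1)) * K * M), ?_⟩
  filter_upwards [htf.eventually hb, hA.abs.eventually (gt_mem_nhds (lt_add_one |A p|)),
    hB.abs.eventually (gt_mem_nhds (lt_add_one |B p|)),
    hC.abs.eventually (gt_mem_nhds (lt_add_one |C p|))] with q h hA hB hC y
  have hM0 : 0 ≤ M := (abs_nonneg _).trans (hM 0)
  have h1 : |A q + B q * y + C q * y ^ 2| ≤
      (|A p| + 1 + (|B p| + 1) + (|C p| + 1)) * (1 + y ^ 2) := by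
    have hy : |y| ≤ 1 + y ^ 2 := by nlinarith [sq_abs y, sq_nonneg (|y| - 1), abs_nonneg y]
    calc _ ≤ |A q| + |B q| * |y| + |C q| * y ^ 2 := by
            refine (abs_add_le _ _).trans (add_le_add ((abs_add_le _ _).trans ?_) ?_)
            · rw [abs_mul]
            · rw [abs_mul, abs_of_nonneg (sq_nonneg y)]
      _ ≤ (|A p| + 1) * (1 + y ^ 2) + (|B p| + 1) * (1 + y ^ 2) + (|C p| + 1) * (1 + y ^ 2) := by
            gcongr
            · nlinarith [abs_nonneg (A p), sq_nonneg y]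
            · linarith
      _ = _ := by ring
  rw [Real.norm_eq_abs, abs_mul, abs_mul]
  calc _ ≤ ((|A p| + 1 + (|B p| + 1) + (|C p| + 1)) * (1 + y ^ 2)) *
        (K * Real.exp (-β * y ^ 2)) * M := by
        gcongr
        · exact h _ _
        · exact hM y
    _ = _ := by ring

lemma key_int {a : ℝ} (ha : a ≠ 0) {f : ℝ → ℝ} (hf : Continuous f) {M : ℝ} (hM : ∀ y, |f y| ≤ M)
    {t : ℝ} (ht : 0 < t) (x A B C : ℝ) :
    Integrable (fun y => (A + B * y + C * y ^ 2) * mehler a x y t * f y) := by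
  obtain ⟨g, hg, hb⟩ := key_bound ha hM (xf := fun _ => x) (tf := fun _ => t) (A := fun _ => A)
    (B := fun _ => B) (C := fun _ => C) (p := 0) continuousAt_const ht continuousAt_const
    continuousAt_const continuousAt_const
  have h := m_cont a x t
  exact hg.mono' (by fun_prop : Continuous _).aestronglyMeasurable
    (ae_of_all _ hb.self_of_nhds)

lemma key_deriv {a : ℝ} (ha : a ≠ 0) {f : ℝ → ℝ} (hf : Continuous f) {M : ℝ}
    (hM : ∀ y, |f y| ≤ M)
    {xf tf A B C A' B' C' : ℝ → ℝ} {p : ℝ} (htf : ContinuousAt tf p) (htp : 0 < tf p)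
    (hA : ContinuousAt A' p) (hB : ContinuousAt B' p) (hC : ContinuousAt C' p)
    (hd : ∀ᶠ q in 𝓝 p, ∀ y, HasDerivAt
      (fun q => (A q + B q * y + C q * y ^ 2) * mehler a (xf q) y (tf q))
      ((A' q + B' q * y + C' q * y ^ 2) * mehler a (xf q) y (tf q)) q) :
    HasDerivAt (fun q => ∫ y, (A q + B q * y + C q * y ^ 2) * mehler a (xf q) y (tf q) * f y)
      (∫ y, (A' p + B' p * y + C' p * y ^ 2) * mehler a (xf p) y (tf p) * f y) p := by
  obtain ⟨g, hg, hb⟩ := key_bound ha hM (xf := xf) htf htp hA hB hC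
  refine (hasDerivAt_integral_of_dominated_loc_of_deriv_le (hb.and hd) ?_
    (key_int ha hf hM htp _ _ _ _) (key_int ha hf hM htp _ _ _ _).aestronglyMeasurable
    (bound := g) (ae_of_all _ fun y q hq => hq.1 y) hg
    (ae_of_all _ fun y q hq => (hq.2 y).mul_const (f y))).2
  filter_upwards with q
  have h := m_cont a (xf q) (tf q)
  exact (by fun_prop : Continuous _).aestronglyMeasurable

lemma u_dx {a : ℝ} (ha : a ≠ 0) {f : ℝ → ℝ} (hf : Continuous f) {M : ℝ} (hM : ∀ y, |f y| ≤ M)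
    {t : ℝ} (ht : 0 < t) (x : ℝ) :
    HasDerivAt (fun x => ∫ y, mehler a x y t * f y)
      (∫ y, (-(Real.cosh (2 * a * t) * x - y) /
        (2 * (Real.sinh (2 * a * t) / (2 * a)))) * mehler a x y t * f y) x := by
  have h0 := (ms_pos ha ht).ne'
  have hd := m_dx a
  have := key_deriv ha hf hM (xf := id) (tf := fun _ => t) (A := fun _ => 1) (B := fun _ => 0)
    (C := fun _ => 0) (p := x)
    (A' := fun x => -(Real.cosh (2 * a * t) * x) / (2 * (Real.sinh (2 * a * t) / (2 * a))))
    (B' := fun _ => 1 / (2 * (Real.sinh (2 * a * t) / (2 * a))))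
    (C' := fun _ => 0) continuousAt_const ht (by fun_prop) (by fun_prop) (by fun_prop) (by
      filter_upwards with q y
      convert hd q y t using 1
      · ext; simp
      · simp only [id]; ring)
  convert this using 1
  · ext; simp
  · congr 1; ext y; simp only [id]; ring

lemma u_dxx {a : ℝ} (ha : a ≠ 0) {f : ℝ → ℝ} (hf : Continuous f) {M : ℝ} (hM : ∀ y, |f y| ≤ M)
    {t : ℝ} (ht : 0 < t) (x : ℝ) :
    HasDerivAt (fun x => ∫ y, (-(Real.cosh (2 * a * t) * x - y) /
        (2 * (Real.sinh (2 * a * t) / (2 * a)))) * mehler a x y t * f y)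
      (∫ y, ((Real.cosh (2 * a * t) * x - y) ^ 2 / (4 * (Real.sinh (2 * a * t) / (2 * a)) ^ 2)
        - Real.cosh (2 * a * t) / (2 * (Real.sinh (2 * a * t) / (2 * a)))) *
        mehler a x y t * f y) x := by
  have h0 := (ms_pos ha ht).ne'
  have hd := m_dxx a
  have := key_deriv ha hf hM (xf := id) (tf := fun _ => t) (p := x)
    (A := fun x => -(Real.cosh (2 * a * t) * x) / (2 * (Real.sinh (2 * a * t) / (2 * a))))
    (B := fun _ => 1 / (2 * (Real.sinh (2 * a * t) / (2 * a))))
    (C := fun _ => 0)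
    (A' := fun x => (Real.cosh (2 * a * t) * x) ^ 2 / (4 * (Real.sinh (2 * a * t) / (2 * a)) ^ 2)
        - Real.cosh (2 * a * t) / (2 * (Real.sinh (2 * a * t) / (2 * a))))
    (B' := fun x => -(2 * Real.cosh (2 * a * t) * x) /
      (4 * (Real.sinh (2 * a * t) / (2 * a)) ^ 2))
    (C' := fun _ => 1 / (4 * (Real.sinh (2 * a * t) / (2 * a)) ^ 2))
    continuousAt_const ht (by fun_prop) (by fun_prop) (by fun_prop) (by
      filter_upwards with q y
      convert hd q y t using 1
      · ext; simp only [id]; ring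
      · simp only [id]; ring)
  convert this using 1
  · ext; congr 1; ext y; simp only [id]; ring
  · congr 1; ext y; simp only [id]; ring

lemma u_dt {a : ℝ} (ha : a ≠ 0) {f : ℝ → ℝ} (hf : Continuous f) {M : ℝ} (hM : ∀ y, |f y| ≤ M)
    {t : ℝ} (ht : 0 < t) (x : ℝ) :
    HasDerivAt (fun t => ∫ y, mehler a x y t * f y)
      (∫ y, (-Real.cosh (2 * a * t) / (2 * (Real.sinh (2 * a * t) / (2 * a)))
        - a ^ 2 * (x ^ 2 + y ^ 2)
        + (Real.cosh (2 * a * t) * (x ^ 2 + y ^ 2) - 2 * x * y) * Real.cosh (2 * a * t) /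
          (4 * (Real.sinh (2 * a * t) / (2 * a)) ^ 2)) * mehler a x y t * f y) t := by
  have h0 := (ms_pos ha ht).ne'
  have hs := (ms_deriv ha t).continuousAt
  have hc := (mc_deriv ha t).continuousAt
  have h2 : 2 * (Real.sinh (2 * a * t) / (2 * a)) ≠ 0 := by positivity
  have h4 : 4 * (Real.sinh (2 * a * t) / (2 * a)) ^ 2 ≠ 0 := by positivity
  have := key_deriv ha hf hM (xf := fun _ => x) (tf := id) (A := fun _ => 1) (B := fun _ => 0)
    (C := fun _ => 0) (p := t)
    (A' := fun t => -Real.cosh (2 * a * t) / (2 * (Real.sinh (2 * a * t) / (2 * a)))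
        - a ^ 2 * x ^ 2 + Real.cosh (2 * a * t) ^ 2 * x ^ 2 /
          (4 * (Real.sinh (2 * a * t) / (2 * a)) ^ 2))
    (B' := fun t => - (2 * x * Real.cosh (2 * a * t)) /
      (4 * (Real.sinh (2 * a * t) / (2 * a)) ^ 2))
    (C' := fun t => - a ^ 2 + Real.cosh (2 * a * t) ^ 2 /
          (4 * (Real.sinh (2 * a * t) / (2 * a)) ^ 2)) continuousAt_id ht
    (((hc.neg.div (hs.const_mul 2) h2).sub continuousAt_const).add
      (((hc.pow 2).mul continuousAt_const).div ((hs.pow 2).const_mul 4) h4))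
    (((hc.const_mul (2 * x)).neg).div ((hs.pow 2).const_mul 4) h4)
    (continuousAt_const.add ((hc.pow 2).div ((hs.pow 2).const_mul 4) h4)) (by
      filter_upwards [lt_mem_nhds ht] with q hq y
      convert m_dt ha x y hq using 1
      · ext; simp
      · simp only [id]; ring)
  convert this using 1
  · ext; simp
  · congr 1; ext y; simp only [id]; ring

lemma u_subst {a : ℝ} (ha : a ≠ 0) (f : ℝ → ℝ) {t : ℝ} (ht : 0 < t) (x : ℝ) :
    ∫ y, mehler a x y t * f y = (Real.sqrt (4 * Real.pi))⁻¹ *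
      Real.exp (-a ^ 2 * (Real.sinh (2 * a * t) / (2 * a)) * x ^ 2 / Real.cosh (2 * a * t)) *
      ∫ z, Real.exp (-(Real.cosh (2 * a * t)) * z ^ 2 / 4) *
        f (Real.sqrt (Real.sinh (2 * a * t) / (2 * a)) * z + x / Real.cosh (2 * a * t)) := by
  have h0 := ms_pos ha ht
  have h := mc_sq ha t
  have hc : 0 < Real.cosh (2 * a * t) := Real.cosh_pos _
  unfold mehler
  generalize Real.cosh (2 * a * t) = c at *
  generalize Real.sinh (2 * a * t) / (2 * a) = s at *
  have hq : 0 < √s := Real.sqrt_pos.2 h0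
  have e1 := Measure.integral_comp_mul_left (fun w : ℝ => (√(4 * Real.pi * s))⁻¹ *
    Real.exp (-(c * (x ^ 2 + (w + x / c) ^ 2) - 2 * x * (w + x / c)) / (4 * s)) * f (w + x / c)) (√s)
  have e2 := integral_add_right_eq_self (μ := volume) (fun y : ℝ => (√(4 * Real.pi * s))⁻¹ *
    Real.exp (-(c * (x ^ 2 + y ^ 2) - 2 * x * y) / (4 * s)) * f y) (x / c)
  rw [e2, abs_of_pos (inv_pos.2 hq), smul_eq_mul, eq_comm, inv_mul_eq_iff_eq_mul₀ hq.ne'] at e1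
  rw [e1, ← integral_const_mul, ← integral_const_mul]
  congr 1; ext z
  have e3 : (-(c * (x ^ 2 + (√s * z + x / c) ^ 2) - 2 * x * (√s * z + x / c)) / (4 * s)) =
     -a ^ 2 * s * x ^ 2 / c + -c * z ^ 2 / 4 := by
    have : √s ^ 2 = s := Real.sq_sqrt h0.le
    generalize √s = r at *
    subst this
    field_simp
    linear_combination (-x ^ 2) * h
  rw [e3, Real.exp_add, Real.sqrt_mul (by positivity)]
  field_simp

lemma u_lim {a : ℝ} (ha : a ≠ 0) {f : ℝ → ℝ} (hf : Continuous f) {M : ℝ} (hM : ∀ y, |f y| ≤ M)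
    (x : ℝ) : Tendsto (fun t => ∫ y, mehler a x y t * f y) (𝓝[>] 0) (𝓝 (f x)) := by
  have key : Tendsto (fun t : ℝ => (Real.sqrt (4 * Real.pi))⁻¹ *
      Real.exp (-a ^ 2 * (Real.sinh (2 * a * t) / (2 * a)) * x ^ 2 / Real.cosh (2 * a * t)) *
      ∫ z, Real.exp (-(Real.cosh (2 * a * t)) * z ^ 2 / 4) *
        f (Real.sqrt (Real.sinh (2 * a * t) / (2 * a)) * z + x / Real.cosh (2 * a * t)))
      (𝓝[>] 0) (𝓝 ((Real.sqrt (4 * Real.pi))⁻¹ * 1 * (∫ z, Real.exp (-(1/4) * z ^ 2) * f x))) := by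
    have hcp : ∀ u : ℝ, Real.cosh u ≠ 0 := fun u => (Real.cosh_pos u).ne'
    apply Tendsto.mul
    · apply Tendsto.const_mul
      apply tendsto_nhdsWithin_of_tendsto_nhds
      have : Continuous fun t : ℝ => Real.exp (-a ^ 2 * (Real.sinh (2 * a * t) / (2 * a)) * x ^ 2 /
        Real.cosh (2 * a * t)) := by fun_prop (disch := simp [hcp])
      simpa using this.tendsto 0
    · refine tendsto_integral_filter_of_dominated_convergence
        (fun z => Real.exp (-(1/4) * z ^ 2) * M) ?_ ?_ ?_ ?_
      · filter_upwards with t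
        exact (by fun_prop : Continuous _).aestronglyMeasurable
      · filter_upwards with t
        refine ae_of_all _ fun z => ?_
        rw [norm_mul, Real.norm_eq_abs, Real.norm_eq_abs, abs_of_pos (Real.exp_pos _)]
        gcongr
        · nlinarith [Real.one_le_cosh (2 * a * t), sq_nonneg z]
        · exact hM _
      · exact (integrable_exp_neg_mul_sq (by norm_num)).mul_const M
      · refine ae_of_all _ fun z => ?_
        apply tendsto_nhdsWithin_of_tendsto_nhds
        have : Continuous fun t : ℝ => Real.exp (-(Real.cosh (2 * a * t)) * z ^ 2 / 4) *
          f (Real.sqrt (Real.sinh (2 * a * t) / (2 * a)) * z + x / Real.cosh (2 * a * t)) := by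
          fun_prop (disch := simp [hcp])
        have h := this.tendsto 0
        have e : -(1/4) * z ^ 2 = -1 * z ^ 2 / 4 := by ring
        rw [e]
        simpa using h
  have e : (Real.sqrt (4 * Real.pi))⁻¹ * 1 * (∫ z, Real.exp (-(1/4) * z ^ 2) * f x) = f x := by
    rw [integral_mul_const, integral_gaussian]
    have : Real.pi / (1 / 4) = 4 * Real.pi := by ring
    rw [this]
    field_simp
  rw [e] at key
  refine key.congr' ?_
  filter_upwards [self_mem_nhdsWithin] with t ht
  exact (u_subst ha f ht x).symm

/-- (Mehler)  For `a ≠ 0`, the Mehler kernel satisfies the harmonic-oscillator heat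
equation `∂_t e_a = ∂_x² e_a - a²x² e_a` for `t > 0`, and for continuous bounded `f`
the function `u(x,t) = ∫ e_a(x,y,t) f(y) dy` satisfies `u_t = u_xx - a²x²u` with
`u(·,t) → f` pointwise as `t → 0⁺`. -/
theorem stmt14 (a : ℝ) (ha : a ≠ 0) :
    (∀ t : ℝ, 0 < t → ∀ x y : ℝ,
      deriv (fun t' => mehler a x y t') t =
        iteratedDeriv 2 (fun x' => mehler a x' y t) x - a ^ 2 * x ^ 2 * mehler a x y t) ∧
    (∀ f : ℝ → ℝ, Continuous f → (∃ C : ℝ, ∀ y : ℝ, |f y| ≤ C) →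
      (∀ t : ℝ, 0 < t → ∀ x : ℝ,
        deriv (fun t' => ∫ y : ℝ, mehler a x y t' * f y) t =
          iteratedDeriv 2 (fun x' => ∫ y : ℝ, mehler a x' y t * f y) x -
            a ^ 2 * x ^ 2 * ∫ y : ℝ, mehler a x y t * f y) ∧
      ∀ x : ℝ, Filter.Tendsto (fun t => ∫ y : ℝ, mehler a x y t * f y)
        (nhdsWithin 0 (Set.Ioi 0)) (nhds (f x))) := by
  refine ⟨fun t ht x y => ?_, fun f hf ⟨M, hM⟩ => ⟨fun t ht x => ?_, u_lim ha hf hM⟩⟩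
  · rw [iteratedDeriv_succ, iteratedDeriv_one, funext fun x => (m_dx a x y t).deriv,
      (m_dxx a x y t).deriv, (m_dt ha x y ht).deriv, m_alg ha x y ht]
    ring
  · rw [iteratedDeriv_succ, iteratedDeriv_one, funext fun x => (u_dx ha hf hM ht x).deriv,
      (u_dxx ha hf hM ht x).deriv, (u_dt ha hf hM ht x).deriv, ← integral_const_mul,
      ← integral_sub]
    · congr 1; ext y
      rw [m_alg ha x y ht]; ring
    · refine (key_int ha hf hM ht x
        ((Real.cosh (2 * a * t) * x) ^ 2 / (4 * (Real.sinh (2 * a * t) / (2 * a)) ^ 2)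
          - Real.cosh (2 * a * t) / (2 * (Real.sinh (2 * a * t) / (2 * a))))
        (-(2 * Real.cosh (2 * a * t) * x) / (4 * (Real.sinh (2 * a * t) / (2 * a)) ^ 2))
        (1 / (4 * (Real.sinh (2 * a * t) / (2 * a)) ^ 2))).congr (ae_of_all _ fun y => ?_)
      ring
    · refine (key_int ha hf hM ht x (a ^ 2 * x ^ 2) 0 0).congr (ae_of_all _ fun y => ?_)
      ring
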